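/- arXiv:2602.23707 — 3 statements merged into one kernel-verified Lean document; each statement's English description precedes it below -/
import Mathlib

section
/- In the f-symmetric setting: let p be a probability mass function on the (finite) set of f-symmetric functions, defining a random f-symmetric function P. Suppose there is δ > 0 such that for every f-symmetric function M with P[P_{n1} = M_{n1}] ≠ 0, one has |P[P = M | P_{n1} = M_{n1}] − ℓ^{n1(n1−1)/2 − n(n−1)/2}| ≤ δ · ℓ^{n1(n1−1)/2 − n(n−1)/2}. Let σ be uniform on G, independent of P. Then ∑_M |P[P^σ = M] − ℓ^{−n(n−1)/2}| ≤ δ + √(∑_{d≥0} S(G, d, n1) · ℓ^{n1·d} − 1), where the sum ranges over all f-symmetric functions M and P[P^σ = M] = (1/#G) ∑_{σ ∈ G} p(M^{σ^{-1}}). In particular the total variation distance between the distribution of P^σ and the uniform distribution on f-symmetric functions is at most δ + √(∑_{d≥0} S(G, d, n1) · ℓ^{n1·d} − 1). -/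
open BigOperators

/-- Ordered pairs of distinct indices in `{1,…,n}`. -/
abbrev OffDiag (n : ℕ) : Type := {p : Fin n × Fin n // p.1 ≠ p.2}

/-- `M` is `f`-symmetric: `M(j,i) = f_{ij}(M(i,j))` for all `i ≠ j`. -/
def IsFSym {n : ℕ} {F : Type} (f : Fin n → Fin n → (F ≃ F)) (M : OffDiag n → F) : Prop :=
  ∀ (i j : Fin n) (h : i ≠ j), M ⟨(j, i), h.symm⟩ = f i j (M ⟨(i, j), h⟩)

/-- The permuted function `M^σ`, with `M^σ(i,j) = M(σ⁻¹ i, σ⁻¹ j)`. -/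
def permApply {n : ℕ} {F : Type} (σ : Equiv.Perm (Fin n)) (M : OffDiag n → F) :
    OffDiag n → F :=
  fun p => M ⟨(σ⁻¹ p.1.1, σ⁻¹ p.1.2), fun h => p.2 (σ⁻¹.injective h)⟩

/-- `P` and `M` have equal restrictions to pairs of indices `< n1`
(i.e. `P_{n1} = M_{n1}`). -/
def RestrictEq {n : ℕ} {F : Type} (n1 : ℕ) (P M : OffDiag n → F) : Prop :=
  ∀ p : OffDiag n, (p.1.1 : ℕ) < n1 → (p.1.2 : ℕ) < n1 → P p = M p

/-- The orbit `G[B]` of a finite set `B` of indices under a group `G` of permutations. -/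
def orbitOfBase {n : ℕ} (G : Subgroup (Equiv.Perm (Fin n))) (B : Finset (Fin n)) :
    Set (Finset (Fin n)) :=
  {S | ∃ σ ∈ G, S = B.image σ}

open Classical in
/-- `S(G, d, n1)`: the fraction of sets in the orbit of `B` under `G` meeting `B` in exactly
`d` elements. -/
noncomputable def mixingFraction {n : ℕ} (G : Subgroup (Equiv.Perm (Fin n)))
    (B : Finset (Fin n)) (d : ℕ) : ℝ :=
  (Nat.card {S : Finset (Fin n) | S ∈ orbitOfBase G B ∧ (S ∩ B).card = d} : ℝ) /
    (Nat.card (orbitOfBase G B) : ℝ)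

open Classical in
/-- The marginal probability `P[P_{n1} = M_{n1}]` of a random `f`-symmetric function with
probability mass function `p`. -/
noncomputable def marginalProb {n : ℕ} {F : Type} [Fintype F]
    (p : (OffDiag n → F) → ℝ) (n1 : ℕ) (M : OffDiag n → F) : ℝ :=
  ∑ M' : OffDiag n → F, if RestrictEq n1 M' M then p M' else 0

/-- Orbit averaging: in a transitive action, `g • y` is uniformly distributed for uniform `g`. -/
theorem card_mul_sum_smul_of_isPretransitive {G Y : Type*} [Group G] [Fintype G] [Fintype Y]
    [MulAction G Y] [MulAction.IsPretransitive G Y] (φ : Y → ℝ) (y : Y) :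
    (Fintype.card Y : ℝ) * ∑ g : G, φ (g • y) = Fintype.card G * ∑ z : Y, φ z := by
  have hconst : ∀ z : Y, ∑ g : G, φ (g • z) = ∑ g : G, φ (g • y) := by
    intro z
    obtain ⟨h, rfl⟩ := MulAction.exists_smul_eq G y z
    simp_rw [smul_smul]
    exact Equiv.sum_comp (Equiv.mulRight h) fun g : G => φ (g • y)
  have hswap : ∑ z : Y, ∑ g : G, φ (g • z) = ∑ g : G, ∑ z : Y, φ z := by
    rw [Finset.sum_comm]
    exact Finset.sum_congr rfl fun g _ => Equiv.sum_comp (MulAction.toPerm g) φ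
  simpa [hconst] using hswap

/-- If a probability vector `p` is within a relative error `δ` of its smoothing `q` along a
relation `R`, then its average over a group is close to uniform, with an error controlled by the
sizes of the sets `{x | R a x ∧ R b (g • x)}`. -/
theorem sum_abs_average_sub_uniform_le {G X : Type*} [Group G] [Fintype G] [Fintype X]
    [MulAction G X] (R : X → X → Prop) [DecidableRel R] (p : X → ℝ)
    (hp0 : ∀ x, 0 ≤ p x) (hp1 : ∑ x, p x = 1) (c δ : ℝ)
    (hc : ∀ a, c * ((Finset.univ.filter fun x => R a x).card : ℝ) = 1)
    (hpq : ∀ x, |p x - c * ∑ a, if R a x then p a else 0| ≤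
      δ * (c * ∑ a, if R a x then p a else 0))
    (w : G → ℝ)
    (hw : ∀ g a b, (Fintype.card X : ℝ) * (c ^ 2 *
      ((Finset.univ.filter fun x => R a x ∧ R b (g • x)).card : ℝ)) ≤ w g) :
    ∑ x, |(∑ g : G, p (g • x)) / (Fintype.card G : ℝ) - (Fintype.card X : ℝ)⁻¹| ≤
      δ + Real.sqrt ((∑ g, w g) / (Fintype.card G : ℝ) - 1) := by
  set q : X → ℝ := fun x => c * ∑ a, if R a x then p a else 0 with hq
  set k : ℝ := (Fintype.card G : ℝ) with hk
  set K : ℝ := (Fintype.card X : ℝ) with hK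
  have hkpos : 0 < k := by rw [hk]; exact_mod_cast Fintype.card_pos
  have hX : Nonempty X := by
    by_contra h
    rw [not_nonempty_iff] at h
    simp at hp1
  have hKpos : 0 < K := by rw [hK]; exact_mod_cast Fintype.card_pos
  have hshift : ∀ (φ : X → ℝ) (g : G), ∑ x, φ (g • x) = ∑ x, φ x := fun φ g =>
    Equiv.sum_comp (MulAction.toPerm g) φ
  have havg : ∀ φ : X → ℝ, ∑ x, (∑ g : G, φ (g • x)) / k = ∑ x, φ x := by
    intro φ
    rw [← Finset.sum_div, Finset.sum_comm, Finset.sum_congr rfl fun g _ => hshift φ g]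
    simp only [Finset.sum_const, Finset.card_univ, nsmul_eq_mul, ← hk]
    field_simp
  have hq1 : ∑ x, q x = 1 := by
    rw [hq, ← Finset.mul_sum, Finset.sum_comm, Finset.mul_sum, ← hp1]
    refine Finset.sum_congr rfl fun a _ => ?_
    rw [← Finset.sum_filter, Finset.sum_const, nsmul_eq_mul, ← mul_assoc, hc, one_mul]
  set A : X → ℝ := fun x => (∑ g : G, q (g • x)) / k with hA
  have hA1 : ∑ x, A x = 1 := (havg q).trans hq1
  have hcorr : ∀ g : G, K * ∑ x, q x * q (g • x) ≤ w g := by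
    intro g
    have hexp : ∀ x, q x * q (g • x) =
        ∑ a, ∑ b, p a * p b * (c ^ 2 * if R a x ∧ R b (g • x) then 1 else 0) := by
      intro x
      rw [hq]
      simp only
      rw [mul_mul_mul_comm, Finset.sum_mul_sum, Finset.mul_sum]
      refine Finset.sum_congr rfl fun a _ => ?_
      rw [Finset.mul_sum]
      refine Finset.sum_congr rfl fun b _ => ?_
      by_cases h1 : R a x <;> by_cases h2 : R b (g • x) <;> simp [h1, h2]
      ring
    calc K * ∑ x, q x * q (g • x)
        = ∑ a, ∑ b, p a * p b * (K * (c ^ 2 *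
            ((Finset.univ.filter fun x => R a x ∧ R b (g • x)).card : ℝ))) := by
          rw [Finset.sum_congr rfl fun x _ => hexp x, Finset.sum_comm, Finset.mul_sum]
          refine Finset.sum_congr rfl fun a _ => ?_
          rw [Finset.sum_comm, Finset.mul_sum]
          refine Finset.sum_congr rfl fun b _ => ?_
          rw [← Finset.mul_sum, ← Finset.mul_sum, Finset.sum_boole]
          ring
      _ ≤ ∑ a, ∑ b, p a * p b * w g :=
          Finset.sum_le_sum fun a _ => Finset.sum_le_sum fun b _ =>
            mul_le_mul_of_nonneg_left (hw g a b) (mul_nonneg (hp0 a) (hp0 b))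
      _ = w g := by
          simp_rw [← Finset.sum_mul, ← Finset.mul_sum, hp1, mul_one]
          rw [hp1, one_mul]
  have hAsq : K * ∑ x, A x ^ 2 ≤ (∑ g, w g) / k := by
    have hsq : ∑ x, A x ^ 2 = (∑ g : G, ∑ x, q x * q (g • x)) / k := by
      have h1 : ∀ g : G, ∑ h : G, ∑ x, q (g • x) * q (h • x) = ∑ h : G, ∑ x, q x * q (h • x) := by
        intro g
        rw [← Equiv.sum_comp (Equiv.mulRight g)]
        refine Finset.sum_congr rfl fun h _ => ?_
        rw [← hshift (fun x => q x * q (h • x)) g]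
        simp [mul_smul]
      have h2 : ∑ x, A x ^ 2 = (∑ g : G, ∑ h : G, ∑ x, q (g • x) * q (h • x)) / k ^ 2 := by
        simp_rw [hA, div_pow, ← Finset.sum_div, sq (∑ g : G, q (g • _)), Finset.sum_mul_sum]
        rw [Finset.sum_comm]
        congr 1
        exact Finset.sum_congr rfl fun g _ => Finset.sum_comm
      rw [h2, Finset.sum_congr rfl fun g _ => h1 g]
      simp only [Finset.sum_const, Finset.card_univ, nsmul_eq_mul, ← hk]
      field_simp
    rw [hsq, ← mul_div_assoc, Finset.mul_sum]
    exact div_le_div_of_nonneg_right (Finset.sum_le_sum fun g _ => hcorr g) hkpos.le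
  have hfar : ∑ x, |A x - K⁻¹| ≤ Real.sqrt ((∑ g, w g) / k - 1) := by
    apply Real.le_sqrt_of_sq_le
    calc (∑ x, |A x - K⁻¹|) ^ 2 ≤ K * ∑ x, |A x - K⁻¹| ^ 2 := by
          simpa using sq_sum_le_card_mul_sum_sq (s := Finset.univ) (f := fun x => |A x - K⁻¹|)
      _ = K * ∑ x, A x ^ 2 - 1 := by
          have : ∀ x, |A x - K⁻¹| ^ 2 = A x ^ 2 - 2 * K⁻¹ * A x + K⁻¹ ^ 2 := by
            intro x; rw [sq_abs]; ring
          simp_rw [this, Finset.sum_add_distrib, Finset.sum_sub_distrib, ← Finset.mul_sum, hA1]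
          simp only [Finset.sum_const, Finset.card_univ, nsmul_eq_mul, ← hK]
          field_simp
          ring
      _ ≤ _ := sub_le_sub_right hAsq 1
  have hnear : ∑ x, |(∑ g : G, p (g • x)) / k - A x| ≤ δ := by
    calc ∑ x, |(∑ g : G, p (g • x)) / k - A x|
        ≤ ∑ x, (∑ g : G, δ * q (g • x)) / k := by
          refine Finset.sum_le_sum fun x _ => ?_
          rw [hA]
          simp only
          rw [← sub_div, ← Finset.sum_sub_distrib, abs_div, abs_of_pos hkpos]
          exact div_le_div_of_nonneg_right ((Finset.abs_sum_le_sum_abs _ _).trans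
            (Finset.sum_le_sum fun g _ => hpq _)) hkpos.le
      _ = δ := by rw [havg fun x => δ * q x, ← Finset.mul_sum, hq1, mul_one]
  refine le_trans (Finset.sum_le_sum fun x _ => abs_sub_le _ (A x) _) ?_
  rw [Finset.sum_add_distrib]
  exact add_le_add hnear hfar

/-- The pairs `i < j` with both entries in `S`. -/
def increasingPairs {n : ℕ} (S : Finset (Fin n)) : Finset (OffDiag n) :=
  Finset.univ.filter fun p => p.1.1 < p.1.2 ∧ p.1.1 ∈ S ∧ p.1.2 ∈ S

theorem card_increasingPairs {n : ℕ} (S : Finset (Fin n)) :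
    (increasingPairs S).card = S.card * (S.card - 1) / 2 := by
  have h1 : (increasingPairs S).card = (S.offDiag.filter fun p => p.1 < p.2).card := by
    rw [← Finset.card_map (Function.Embedding.subtype _)]
    congr 1
    ext ⟨i, j⟩
    simp only [increasingPairs, Finset.mem_map, Finset.mem_filter, Finset.mem_univ, true_and,
      Function.Embedding.coe_subtype, Subtype.exists, Finset.mem_offDiag]
    constructor
    · rintro ⟨_, hne, h, rfl⟩
      exact ⟨⟨h.2.1, h.2.2, hne⟩, h.1⟩
    · rintro ⟨⟨hi, hj, hne⟩, hlt⟩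
      exact ⟨(i, j), hne, ⟨hlt, hi, hj⟩, rfl⟩
  have h2 : (S.offDiag.filter fun p => ¬ p.1 < p.2).card =
      (S.offDiag.filter fun p => p.1 < p.2).card := by
    refine Finset.card_nbij' Prod.swap Prod.swap ?_ ?_
      (fun _ _ => Prod.swap_swap _) (fun _ _ => Prod.swap_swap _)
    all_goals
      rintro ⟨i, j⟩
      simp only [Finset.coe_filter, Finset.mem_offDiag, Set.mem_ofPred_eq, Prod.swap_prod_mk]
      rintro ⟨⟨hi, hj, hne⟩, hlt⟩
      refine ⟨⟨hj, hi, hne.symm⟩, ?_⟩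
      omega
  have h3 := Finset.card_filter_add_card_filter_not (s := S.offDiag) fun p => p.1 < p.2
  rw [Finset.offDiag_card] at h3
  rw [h1, Nat.mul_sub_one]
  omega

/-- The `f`-symmetric functions agreeing with a given one on a symmetric set of pairs are
parametrised by their free values above the diagonal. -/
theorem card_isFSym_agree {F : Type} [Fintype F] {n : ℕ} {f : Fin n → Fin n → (F ≃ F)}
    (hf : ∀ i j : Fin n, i ≠ j → f j i = (f i j).symm)
    (T : Fin n → Fin n → Prop) (hT : ∀ i j, T i j → T j i) (M₀ : {M // IsFSym f M})
    [Fintype {M // IsFSym f M}]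
    [DecidablePred fun M : {M // IsFSym f M} => ∀ p : OffDiag n, T p.1.1 p.1.2 → M₀.1 p = M.1 p]
    [DecidablePred fun p : OffDiag n => p.1.1 < p.1.2 ∧ ¬ T p.1.1 p.1.2] :
    (Finset.univ.filter fun M : {M // IsFSym f M} =>
        ∀ p : OffDiag n, T p.1.1 p.1.2 → M₀.1 p = M.1 p).card =
      Fintype.card F ^
        (Finset.univ.filter fun p : OffDiag n => p.1.1 < p.1.2 ∧ ¬ T p.1.1 p.1.2).card := by
  classical
  rw [← Fintype.card_subtype, ← Fintype.card_subtype, ← Fintype.card_fun]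
  refine Fintype.card_of_bijective
    (f := fun M p => (M.1.1 p.1 : F)) ⟨?_, ?_⟩
  · rintro ⟨⟨M, hM⟩, hMT⟩ ⟨⟨M', hM'⟩, hMT'⟩ h
    have key : ∀ p : OffDiag n, p.1.1 < p.1.2 → M p = M' p := by
      intro p hp
      by_cases hpT : T p.1.1 p.1.2
      · exact (hMT p hpT).symm.trans (hMT' p hpT)
      · exact congrFun h ⟨p, hp, hpT⟩
    simp only [Subtype.mk.injEq]
    funext ⟨⟨i, j⟩, hij⟩
    rcases lt_or_gt_of_ne hij with hlt | hlt
    · exact key _ hlt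
    · rw [hM j i hij.symm, hM' j i hij.symm, key _ hlt]
  · intro g
    let up : ∀ i j : Fin n, i < j → F := fun i j h =>
      if hT : T i j then M₀.1 ⟨(i, j), h.ne⟩ else g ⟨⟨(i, j), h.ne⟩, h, hT⟩
    let M : OffDiag n → F := fun p =>
      if h : p.1.1 < p.1.2 then up _ _ h
      else f p.1.2 p.1.1 (up p.1.2 p.1.1 (lt_of_le_of_ne (not_lt.mp h) p.2.symm))
    have hM : IsFSym f M := by
      intro i j hij
      rcases lt_or_gt_of_ne hij with hlt | hlt
      · simp [M, hlt, hlt.not_gt]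
      · simp [M, hlt, hlt.not_gt, hf j i hij.symm]
    have hMT : ∀ p : OffDiag n, T p.1.1 p.1.2 → M₀.1 p = M p := by
      rintro ⟨⟨i, j⟩, hij⟩ hp
      rcases lt_or_gt_of_ne hij with hlt | hlt
      · simp_all [M, up]
      · simp only [M, up, hlt.not_gt, hT _ _ hp, dif_pos, dif_neg, not_false_iff]
        exact M₀.2 j i hij.symm
    refine ⟨⟨⟨M, hM⟩, hMT⟩, ?_⟩
    funext ⟨p, hp, hpT⟩
    simp [M, up, hp, hpT]

theorem card_increasingPairs_inter_add {n : ℕ} (B C : Finset (Fin n)) :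
    (Finset.univ.filter fun p : OffDiag n => p.1.1 < p.1.2 ∧
        ¬ ((p.1.1 ∈ B ∧ p.1.2 ∈ B) ∨ (p.1.1 ∈ C ∧ p.1.2 ∈ C))).card +
      (increasingPairs B).card + (increasingPairs C).card =
      (increasingPairs (Finset.univ : Finset (Fin n))).card + (increasingPairs (B ∩ C)).card := by
  have h1 : increasingPairs (B ∩ C) = increasingPairs B ∩ increasingPairs C := by
    ext p
    simp only [increasingPairs, Finset.mem_filter, Finset.mem_inter, Finset.mem_univ, true_and]
    tauto
  have h2 : (Finset.univ.filter fun p : OffDiag n => p.1.1 < p.1.2 ∧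
        ¬ ((p.1.1 ∈ B ∧ p.1.2 ∈ B) ∨ (p.1.1 ∈ C ∧ p.1.2 ∈ C))) =
      increasingPairs Finset.univ \ (increasingPairs B ∪ increasingPairs C) := by
    ext p
    simp only [increasingPairs, Finset.mem_filter, Finset.mem_sdiff, Finset.mem_union,
      Finset.mem_univ, true_and]
    tauto
  have h3 : increasingPairs B ∪ increasingPairs C ⊆ increasingPairs Finset.univ := by
    intro p
    simp only [increasingPairs, Finset.mem_filter, Finset.mem_union, Finset.mem_univ, true_and]
    tauto
  have h4 := Finset.card_sdiff_add_card_eq_card h3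
  have h5 := Finset.card_union_add_card_inter (increasingPairs B) (increasingPairs C)
  rw [h1, h2]
  omega

open Classical Pointwise in
/-- The moments of the intersection size of `B` with a uniform translate, via the orbit. -/
theorem tsum_mixingFraction_mul {n : ℕ} (G : Subgroup (Equiv.Perm (Fin n)))
    (B : Finset (Fin n)) (φ : ℕ → ℝ) :
    ∑' d : ℕ, mixingFraction G B d * φ d =
      (∑ g : G, φ (B.image (g : Equiv.Perm (Fin n)) ∩ B).card) / (Fintype.card G : ℝ) := by
  have horb : orbitOfBase G B = MulAction.orbit G B := by
    ext S
    simp only [orbitOfBase, Set.mem_ofPred_eq, MulAction.mem_orbit_iff, Subtype.exists]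
    constructor
    · rintro ⟨σ, hσ, rfl⟩
      exact ⟨σ, hσ, rfl⟩
    · rintro ⟨σ, hσ, rfl⟩
      exact ⟨σ, hσ, rfl⟩
  have hav := card_mul_sum_smul_of_isPretransitive (G := G) (Y := MulAction.orbit G B)
    (fun S => φ ((S : Finset (Fin n)) ∩ B).card) ⟨B, MulAction.mem_orbit_self B⟩
  have hG : (0 : ℝ) < Fintype.card G := by exact_mod_cast Fintype.card_pos
  have hO : (0 : ℝ) < Fintype.card (MulAction.orbit G B) := by
    have : Nonempty (MulAction.orbit G B) := ⟨⟨B, MulAction.mem_orbit_self B⟩⟩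
    exact_mod_cast Fintype.card_pos
  have hcard : ∀ d, (Nat.card {S : Finset (Fin n) | S ∈ orbitOfBase G B ∧ (S ∩ B).card = d} : ℝ)
      = ((Finset.univ.filter fun S : MulAction.orbit G B => (S.1 ∩ B).card = d).card : ℝ) := by
    intro d
    rw [← Fintype.card_subtype, ← Nat.card_eq_fintype_card, horb]
    norm_cast
    exact Nat.card_congr (Equiv.subtypeSubtypeEquivSubtypeInter _ _).symm
  have hterm : ∀ d, mixingFraction G B d * φ d =
      (∑ S : MulAction.orbit G B with (S.1 ∩ B).card = d, φ (S.1 ∩ B).card) /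
        Fintype.card (MulAction.orbit G B) := by
    intro d
    rw [Finset.sum_congr rfl fun S hS => by rw [(Finset.mem_filter.mp hS).2], Finset.sum_const,
      nsmul_eq_mul, ← hcard, mixingFraction, ← Nat.card_eq_fintype_card, horb]
    ring
  have hsum : ∑' d : ℕ, mixingFraction G B d * φ d =
      (∑ S : MulAction.orbit G B, φ (S.1 ∩ B).card) / Fintype.card (MulAction.orbit G B) := by
    rw [tsum_congr hterm, tsum_eq_sum (s := Finset.range (n + 1)), ← Finset.sum_div,
      Finset.sum_fiberwise_of_maps_to]
    · intro S _
      rw [Finset.mem_range, Nat.lt_succ_iff]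
      simpa using Finset.card_le_univ (S.1 ∩ B)
    · intro d hd
      rw [Finset.sum_eq_zero, zero_div]
      intro S hS
      refine absurd ?_ hd
      rw [← (Finset.mem_filter.mp hS).2, Finset.mem_range, Nat.lt_succ_iff]
      simpa using Finset.card_le_univ (S.1 ∩ B)
  rw [hsum, div_eq_div_iff hO.ne' hG.ne', mul_comm, ← hav, mul_comm]
  rfl

theorem IsFSym.permApply {F : Type} {n : ℕ} {f : Fin n → Fin n → (F ≃ F)}
    {σ : Equiv.Perm (Fin n)} (hσ : ∀ i j : Fin n, i ≠ j → f (σ i) (σ j) = f i j)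
    {M : OffDiag n → F} (hM : IsFSym f M) : IsFSym f (permApply σ M) := by
  intro i j hij
  have hne : σ⁻¹ i ≠ σ⁻¹ j := fun h => hij (σ⁻¹.injective h)
  have h := hσ _ _ hne
  rw [show σ (σ⁻¹ i) = i by simp, show σ (σ⁻¹ j) = j by simp] at h
  rw [h]
  exact hM _ _ hne

/-- A group of permutations preserving `f` acts on the `f`-symmetric functions. -/
@[reducible] def fSymMulAction {F : Type} {n : ℕ} {f : Fin n → Fin n → (F ≃ F)}
    (G : Subgroup (Equiv.Perm (Fin n)))
    (hG : ∀ σ ∈ G, ∀ i j : Fin n, i ≠ j → f (σ i) (σ j) = f i j) :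
    MulAction G {M : OffDiag n → F // IsFSym f M} where
  smul σ M := ⟨permApply σ.1 M.1, M.2.permApply (hG σ.1 σ.2)⟩
  one_smul _ := rfl
  mul_smul _ _ _ := rfl

open Classical in
/-- **Equidistribution of `f`-symmetric functions after a random permutation.**  Let `p` be
a probability mass function supported on `f`-symmetric functions such that the conditional
distribution of `P` given its restriction `P_{n1}` is within a factor `1 ± δ` of uniform.
Then for `σ` uniform in `G`, independent of `P`,
`∑_M |P[P^σ = M] - ℓ^{-n(n-1)/2}| ≤ δ + √(∑_{d≥0} S(G,d,n1) ℓ^{n1·d} - 1)`,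
the sum ranging over all `f`-symmetric `M`. -/
theorem fSymmetric_equidistribution (F : Type) [Fintype F] (ℓ : ℕ)
    (hℓ : Fintype.card F = ℓ) (n n1 : ℕ) (hn1 : 1 ≤ n1) (hn1n : n1 ≤ n)
    (f : Fin n → Fin n → (F ≃ F)) (hf : ∀ i j : Fin n, i ≠ j → f j i = (f i j).symm)
    (G : Subgroup (Equiv.Perm (Fin n)))
    (hG : ∀ σ ∈ G, ∀ i j : Fin n, i ≠ j → f (σ i) (σ j) = f i j)
    (p : (OffDiag n → F) → ℝ)
    (hp0 : ∀ M, 0 ≤ p M)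
    (hpsupp : ∀ M, ¬ IsFSym f M → p M = 0)
    (hp1 : ∑ M : OffDiag n → F, p M = 1)
    (δ : ℝ) (hδ : 0 < δ)
    (hcond : ∀ M : OffDiag n → F, IsFSym f M → marginalProb p n1 M ≠ 0 →
      |p M / marginalProb p n1 M -
          (ℓ : ℝ) ^ (((n1 * (n1 - 1) / 2 : ℕ) : ℤ) - ((n * (n - 1) / 2 : ℕ) : ℤ))|
        ≤ δ * (ℓ : ℝ) ^ (((n1 * (n1 - 1) / 2 : ℕ) : ℤ) - ((n * (n - 1) / 2 : ℕ) : ℤ))) :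
    ∑ M : {M : OffDiag n → F // IsFSym f M},
        |(∑ σ : G, p (permApply ((σ : Equiv.Perm (Fin n)))⁻¹ M.1)) / (Nat.card G : ℝ) -
          (ℓ : ℝ) ^ (-((n * (n - 1) / 2 : ℕ) : ℤ))|
      ≤ δ +
        Real.sqrt
          ((∑' d : ℕ,
              mixingFraction G (Finset.univ.filter fun i : Fin n => (i : ℕ) < n1) d *
                (ℓ : ℝ) ^ (n1 * d)) - 1) := by
  have hsum : ∀ g : (OffDiag n → F) → ℝ, (∀ M, ¬ IsFSym f M → g M = 0) →
      ∑ M, g M = ∑ M : {M : OffDiag n → F // IsFSym f M}, g M.1 := by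
    intro g hg
    rw [← Finset.sum_subtype (Finset.univ.filter (IsFSym f)) (by simp) g]
    exact (Finset.sum_filter_of_ne fun M _ hM => by_contra fun h => hM (hg M h)).symm
  have hp1' : ∑ M : {M : OffDiag n → F // IsFSym f M}, p M.1 = 1 := (hsum p hpsupp).symm.trans hp1
  obtain ⟨M₁⟩ : Nonempty {M : OffDiag n → F // IsFSym f M} := by
    by_contra h
    rw [not_nonempty_iff] at h
    simp at hp1'
  rcases Nat.eq_zero_or_pos ℓ with hℓ0 | hℓpos
  · have hF : IsEmpty F := Fintype.card_eq_zero_iff.mp (hℓ.trans hℓ0)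
    have hO : IsEmpty (OffDiag n) := ⟨fun x => hF.false (M₁.1 x)⟩
    have hn : n = 1 := by
      by_contra hne
      have h2 : 1 < n := by omega
      exact hO.false ⟨(⟨0, by omega⟩, ⟨1, h2⟩), by simp⟩
    have hpM : ∀ M : OffDiag n → F, p M = 1 := by
      intro M
      rw [← hp1, Fintype.sum_subsingleton _ M]
    refine le_trans (le_of_eq ?_) (add_nonneg hδ.le (Real.sqrt_nonneg _))
    refine Finset.sum_eq_zero fun M _ => ?_
    simp [hpM, hn]
  have hℓne : (ℓ : ℝ) ≠ 0 := by exact_mod_cast hℓpos.ne'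
  have hℓ1 : (1 : ℝ) ≤ ℓ := by exact_mod_cast hℓpos
  set B : Finset (Fin n) := Finset.univ.filter fun i : Fin n => (i : ℕ) < n1 with hB
  have hBcard : B.card = n1 := by
    rw [hB, Fin.card_filter_val_lt, min_eq_right hn1n]
  set N : ℕ := n * (n - 1) / 2 with hN
  set m : ℕ := n1 * (n1 - 1) / 2 with hm
  have heuniv : (increasingPairs (Finset.univ : Finset (Fin n))).card = N := by
    rw [card_increasingPairs, Finset.card_fin]
  have heB : (increasingPairs B).card = m := by rw [card_increasingPairs, hBcard]
  have hXcard : Fintype.card {M : OffDiag n → F // IsFSym f M} = ℓ ^ N := by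
    have h := card_isFSym_agree hf (fun _ _ => False) (fun _ _ h => h) M₁
    rw [hℓ] at h
    rw [← heuniv, ← Finset.card_univ]
    simpa [increasingPairs] using h
  let _ := fSymMulAction G hG
  set c : ℝ := (ℓ : ℝ) ^ ((m : ℤ) - (N : ℤ)) with hc
  have hmarg : ∀ M : {M : OffDiag n → F // IsFSym f M}, marginalProb p n1 M.1 =
      ∑ a : {M : OffDiag n → F // IsFSym f M},
        if (∀ x : OffDiag n, x.1.1 ∈ B ∧ x.1.2 ∈ B → a.1 x = M.1 x) then p a.1 else 0 := by
    intro M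
    rw [marginalProb, hsum]
    · refine Finset.sum_congr rfl fun a _ => ?_
      simp [RestrictEq, hB]
    · intro M' hM'
      simp [hpsupp M' hM']
  have hmain := sum_abs_average_sub_uniform_le (G := G)
    (fun a b : {M : OffDiag n → F // IsFSym f M} =>
      ∀ x : OffDiag n, x.1.1 ∈ B ∧ x.1.2 ∈ B → a.1 x = b.1 x)
    (fun M => p M.1) (fun M => hp0 M.1) hp1' c δ ?_ ?_
    (fun g => (ℓ : ℝ) ^ (n1 * (B.image ((g⁻¹ : G) : Equiv.Perm (Fin n)) ∩ B).card)) ?_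
  · rw [tsum_mixingFraction_mul G B fun d => (ℓ : ℝ) ^ (n1 * d), ← Equiv.sum_comp (Equiv.inv G)]
    refine le_trans (le_of_eq ?_) hmain
    refine Finset.sum_congr rfl fun M _ => ?_
    rw [hXcard, ← Equiv.sum_comp (Equiv.inv G), Nat.card_eq_fintype_card, zpow_neg,
      zpow_natCast, Nat.cast_pow]
    simp only [Equiv.inv_apply, InvMemClass.coe_inv, inv_inv]
    rfl
  · intro a
    have h := card_isFSym_agree hf (fun i j => i ∈ B ∧ j ∈ B) (fun i j h => h.symm) a
    have h2 := card_increasingPairs_inter_add B B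
    simp only [or_self, Finset.inter_self] at h2
    rw [h, hℓ, hc, Nat.cast_pow, ← zpow_natCast, ← zpow_add₀ hℓne]
    convert zpow_zero _
    omega
  · intro M
    rw [← hmarg]
    by_cases h0 : marginalProb p n1 M.1 = 0
    · have : p M.1 ≤ marginalProb p n1 M.1 := by
        rw [hmarg]
        refine le_trans (le_of_eq ?_) (Finset.single_le_sum (fun a _ => ?_) (Finset.mem_univ M))
        · simp
        · split_ifs
          exacts [hp0 _, le_rfl]
      simp [h0, le_antisymm (this.trans h0.le) (hp0 _)]
    · have hpos : 0 < marginalProb p n1 M.1 := by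
        refine lt_of_le_of_ne ?_ (Ne.symm h0)
        rw [hmarg]
        refine Finset.sum_nonneg fun a _ => ?_
        split_ifs
        exacts [hp0 _, le_rfl]
      have h := mul_le_mul_of_nonneg_right (hcond M.1 M.2 h0) hpos.le
      rw [← abs_of_pos hpos, ← abs_mul, abs_of_pos hpos, sub_mul, div_mul_cancel₀ _ h0] at h
      rwa [← mul_assoc]
  · intro g a b
    set C : Finset (Fin n) := B.image ((g⁻¹ : G) : Equiv.Perm (Fin n)) with hC
    have hCcard : C.card = n1 := by
      rw [hC, Finset.card_image_of_injective _ (Equiv.injective _), hBcard]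
    have heC : (increasingPairs C).card = m := by rw [card_increasingPairs, hCcard]
    have h2 := card_increasingPairs_inter_add B C
    rw [heB, heC, heuniv, card_increasingPairs (B ∩ C)] at h2
    have hcount : (Finset.univ.filter fun x : {M : OffDiag n → F // IsFSym f M} =>
        (∀ y : OffDiag n, y.1.1 ∈ B ∧ y.1.2 ∈ B → a.1 y = x.1 y) ∧
        ∀ y : OffDiag n, y.1.1 ∈ B ∧ y.1.2 ∈ B → b.1 y = (g • x).1 y).card ≤
        ℓ ^ (Finset.univ.filter fun p : OffDiag n => p.1.1 < p.1.2 ∧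
          ¬ ((p.1.1 ∈ B ∧ p.1.2 ∈ B) ∨ (p.1.1 ∈ C ∧ p.1.2 ∈ C))).card := by
      by_cases hex : ∃ x₀ : {M : OffDiag n → F // IsFSym f M},
          (∀ y : OffDiag n, y.1.1 ∈ B ∧ y.1.2 ∈ B → a.1 y = x₀.1 y) ∧
          ∀ y : OffDiag n, y.1.1 ∈ B ∧ y.1.2 ∈ B → b.1 y = (g • x₀).1 y
      · obtain ⟨x₀, ha, hb⟩ := hex
        rw [← hℓ, ← card_isFSym_agree hf
          (fun i j => (i ∈ B ∧ j ∈ B) ∨ (i ∈ C ∧ j ∈ C)) (fun _ _ h => h.imp And.symm And.symm) x₀]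
        refine Finset.card_le_card fun x hx => ?_
        obtain ⟨hxa, hxb⟩ := (Finset.mem_filter.mp hx).2
        refine Finset.mem_filter.mpr ⟨Finset.mem_univ _, ?_⟩
        rintro ⟨⟨i, j⟩, hij⟩ (hy | ⟨hi, hj⟩)
        · exact (ha _ hy).symm.trans (hxa _ hy)
        · obtain ⟨i', hi', rfl⟩ := Finset.mem_image.mp hi
          obtain ⟨j', hj', rfl⟩ := Finset.mem_image.mp hj
          have hne : i' ≠ j' := fun h => hij (by simp only [h])
          exact (hb ⟨(i', j'), hne⟩ ⟨hi', hj'⟩).symm.trans (hxb ⟨(i', j'), hne⟩ ⟨hi', hj'⟩)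
      · rw [Finset.filter_false_of_mem fun x _ hx => hex ⟨x, hx⟩]
        simp
    set u := (Finset.univ.filter fun p : OffDiag n => p.1.1 < p.1.2 ∧
          ¬ ((p.1.1 ∈ B ∧ p.1.2 ∈ B) ∨ (p.1.1 ∈ C ∧ p.1.2 ∈ C))).card with hu
    have hd : (B ∩ C).card ≤ n1 := hBcard ▸ Finset.card_le_card Finset.inter_subset_left
    have hexp : (B ∩ C).card * ((B ∩ C).card - 1) / 2 ≤ n1 * (B ∩ C).card :=
      (Nat.div_le_self _ _).trans ((Nat.mul_le_mul_left _ (by omega)).trans_eq (mul_comm _ n1))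
    have hbase : (ℓ : ℝ) ^ N * (c ^ 2 * (ℓ : ℝ) ^ u) =
        (ℓ : ℝ) ^ ((B ∩ C).card * ((B ∩ C).card - 1) / 2) := by
      rw [hc, ← zpow_natCast, ← zpow_natCast, ← zpow_natCast, ← zpow_natCast, ← zpow_mul,
        ← zpow_add₀ hℓne, ← zpow_add₀ hℓne]
      congr 1
      push_cast [← h2]
      omega
    calc _ ≤ (ℓ : ℝ) ^ N * (c ^ 2 * (ℓ : ℝ) ^ u) := by
          rw [hXcard, Nat.cast_pow]
          gcongr
          exact_mod_cast hcount
      _ ≤ _ := by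
          rw [hbase, Finset.inter_comm C B]
          exact pow_le_pow_right₀ hℓ1 hexp
end

section
/- Let {1,…,n} = O ⊔ E be a partition with #O = n' ≥ 1 and #E = n'' ≥ 1, let 1 ≤ n1 ≤ n, and set n1' = #(O ∩ {1,…,n1}) and n1'' = #(E ∩ {1,…,n1}). Then for every integer d ≥ 0, #{S ⊆ {1,…,n} : #(S ∩ O) = n1', #(S ∩ E) = n1'', #(S ∩ {1,…,n1}) = d} ≤ (1/d!) · ((n1')²/n' + (n1'')²/n'')^d · C(n', n1') · C(n'', n1''), as an inequality of real numbers, where C(a,b) denotes the binomial coefficient. Equivalently, for G = S_{n'} × S_{n''} ⊆ S_n acting on O and E independently, the fraction S(G, d, n1) of sets in the orbit of {1,…,n1} meeting {1,…,n1} in exactly d elements satisfies S(G, d, n1) ≤ (1/d!) · ((n1')²/n' + (n1'')²/n'')^d. -/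
open BigOperators

theorem choose_sub_mul_pow_le {m a : ℕ} (ham : a ≤ m) :
    ∀ {i : ℕ}, i ≤ a → (m - i).choose (a - i) * m ^ i ≤ a ^ i * m.choose a
  | 0, _ => by simp
  | i + 1, h => by
    have ih := choose_sub_mul_pow_le ham (Nat.le_of_succ_le h)
    obtain ⟨p, rfl⟩ := Nat.exists_eq_add_of_le h
    obtain ⟨q, rfl⟩ := Nat.exists_eq_add_of_le ham
    have e1 : i + 1 + p + q - (i + 1) = p + q := by omega
    have e2 : i + 1 + p - (i + 1) = p := by omega
    have e3 : i + 1 + p + q - i = p + q + 1 := by omega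
    have e4 : i + 1 + p - i = p + 1 := by omega
    rw [e3, e4] at ih
    rw [e1, e2]
    have key : (p + q).choose p * (i + 1 + p + q)
        ≤ (i + 1 + p) * (p + q + 1).choose (p + 1) := by
      have h1 := Nat.add_one_mul_choose_eq (p + q) p
      refine Nat.le_of_mul_le_mul_left ?_ (by omega : 0 < p + q + 1)
      calc (p + q + 1) * ((p + q).choose p * (i + 1 + p + q))
          = (p + q + 1).choose (p + 1) * ((p + 1) * (i + 1 + p + q)) := by
            rw [← mul_assoc, h1, mul_assoc]
        _ ≤ (p + q + 1).choose (p + 1) * ((i + 1 + p) * (p + q + 1)) := by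
            refine Nat.mul_le_mul_left _ ?_
            nlinarith [Nat.zero_le (i * q)]
        _ = _ := by ring
    calc (p + q).choose p * (i + 1 + p + q) ^ (i + 1)
        = (p + q).choose p * (i + 1 + p + q) * (i + 1 + p + q) ^ i := by ring
      _ ≤ (i + 1 + p) * (p + q + 1).choose (p + 1) * (i + 1 + p + q) ^ i := by gcongr
      _ = (i + 1 + p) * ((p + q + 1).choose (p + 1) * (i + 1 + p + q) ^ i) := by ring
      _ ≤ (i + 1 + p) * ((i + 1 + p) ^ i * (i + 1 + p + q).choose (i + 1 + p)) := by gcongr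
      _ = _ := by ring

/-- An upper bound for the point masses of the hypergeometric distribution. -/
theorem choose_mul_choose_sub_le {m a : ℕ} (hm : 1 ≤ m) (ham : a ≤ m) (i : ℕ) :
    ((a.choose i * (m - a).choose (a - i) : ℕ) : ℝ)
      ≤ ((a : ℝ) ^ 2 / m) ^ i / i.factorial * m.choose a := by
  rcases lt_or_ge a i with hi | hi
  · rw [Nat.choose_eq_zero_of_lt hi]
    simp only [zero_mul, Nat.cast_zero]
    positivity
  have hm0 : (0 : ℝ) < m := by exact_mod_cast hm
  have h1 : ((m - a).choose (a - i) : ℝ) ≤ (m - i).choose (a - i) := by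
    exact_mod_cast Nat.choose_le_choose _ (by omega)
  have h2 : ((m - i).choose (a - i) : ℝ) ≤ (a : ℝ) ^ i * m.choose a / (m : ℝ) ^ i := by
    rw [le_div_iff₀ (by positivity)]
    exact_mod_cast choose_sub_mul_pow_le ham hi
  have h3 : (a.choose i : ℝ) ≤ (a : ℝ) ^ i / i.factorial := Nat.choose_le_pow_div i a
  push_cast
  calc (a.choose i : ℝ) * (m - a).choose (a - i)
      ≤ (a : ℝ) ^ i / i.factorial * ((a : ℝ) ^ i * m.choose a / (m : ℝ) ^ i) := by
        gcongr
        exact h1.trans h2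
    _ = _ := by
        rw [div_pow]
        field_simp
        ring

section Counting

variable {α : Type*} [DecidableEq α]

theorem card_filter_card_inter_le {A O : Finset α} (hA : A ⊆ O) (a i : ℕ) :
    ((O.powersetCard a).filter fun T => (T ∩ A).card = i).card
      ≤ A.card.choose i * (O.card - A.card).choose (a - i) := by
  rw [← Finset.card_sdiff_of_subset hA, ← Finset.card_powersetCard, ← Finset.card_powersetCard,
    ← Finset.card_product]
  refine Finset.card_le_card_of_injOn (fun T => (T ∩ A, T \ A)) ?_ ?_
  · intro T hT
    simp only [Finset.coe_filter, Finset.mem_powersetCard, Set.mem_ofPred_eq] at hT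
    obtain ⟨⟨hTO, hTa⟩, hTi⟩ := hT
    simp only [Finset.coe_product, Set.mem_prod, Finset.mem_coe, Finset.mem_powersetCard]
    refine ⟨⟨Finset.inter_subset_right, hTi⟩, Finset.sdiff_subset_sdiff hTO subset_rfl, ?_⟩
    have := Finset.card_sdiff_add_card_inter T A
    omega
  · intro T _ T' _ h
    simp only [Prod.mk.injEq] at h
    rw [← Finset.sdiff_union_inter T A, ← Finset.sdiff_union_inter T' A, h.1, h.2]

theorem card_filter_inter_le_sum_antidiagonal [Fintype α] {O E : Finset α}
    (hdisj : Disjoint O E) (hunion : O ∪ E = Finset.univ) (N : Finset α) (a b d : ℕ) :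
    (Finset.univ.filter fun S : Finset α =>
        (S ∩ O).card = a ∧ (S ∩ E).card = b ∧ (S ∩ N).card = d).card
      ≤ ∑ p ∈ Finset.HasAntidiagonal.antidiagonal d,
          ((O.powersetCard a).filter fun T => (T ∩ (N ∩ O)).card = p.1).card *
            ((E.powersetCard b).filter fun T => (T ∩ (N ∩ E)).card = p.2).card := by
  have hsplit : ∀ S : Finset α, S ∩ O ∪ S ∩ E = S := fun S => by
    rw [← Finset.inter_union_distrib_left, hunion, Finset.inter_univ]
  simp_rw [← Finset.card_product]
  rw [← Finset.card_sigma]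
  refine Finset.card_le_card_of_injOn
    (fun S => ⟨((S ∩ O ∩ (N ∩ O)).card, (S ∩ E ∩ (N ∩ E)).card), (S ∩ O, S ∩ E)⟩) ?_ ?_
  · intro S hS
    simp only [Finset.coe_filter, Finset.mem_univ, true_and, Set.mem_ofPred_eq] at hS
    obtain ⟨hSO, hSE, hSN⟩ := hS
    simp only [Finset.mem_coe, Finset.mem_sigma, Finset.HasAntidiagonal.mem_antidiagonal,
      Finset.mem_product,
      Finset.mem_filter, Finset.mem_powersetCard, Finset.inter_subset_right, hSO, hSE, and_self,
      and_true]
    rw [← Finset.inter_inter_distrib_right, ← Finset.inter_inter_distrib_right,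
      ← Finset.card_union_of_disjoint, hsplit, hSN]
    exact hdisj.mono Finset.inter_subset_right Finset.inter_subset_right
  · intro S _ S' _ h
    simp only [Sigma.mk.injEq] at h
    have h2 := eq_of_heq h.2
    simp only [Prod.mk.injEq] at h2
    rw [← hsplit S, ← hsplit S', h2.1, h2.2]

end Counting

theorem sum_antidiagonal_pow_div_factorial (x y : ℝ) (d : ℕ) :
    ∑ p ∈ Finset.HasAntidiagonal.antidiagonal d,
        x ^ p.1 / p.1.factorial * (y ^ p.2 / p.2.factorial)
      = 1 / d.factorial * (x + y) ^ d := by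
  rw [(Commute.all x y).add_pow', Finset.mul_sum]
  refine Finset.sum_congr rfl fun p hp => ?_
  rw [Finset.HasAntidiagonal.mem_antidiagonal] at hp
  subst hp
  have h : (((p.1 + p.2).choose p.1 : ℕ) : ℝ) * p.1.factorial * p.2.factorial
      = (p.1 + p.2).factorial := by
    rw [Nat.choose_symm_add]
    exact_mod_cast Nat.add_choose_mul_factorial_mul_factorial p.1 p.2
  rw [nsmul_eq_mul, ← h]
  have : (((p.1 + p.2).choose p.1 : ℕ) : ℝ) ≠ 0 := by
    exact_mod_cast (Nat.choose_pos (Nat.le_add_right _ _)).ne'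
  field_simp

/-- **Mixing bound for products of symmetric groups.**  Let `{1,…,n} = O ⊔ E` be a partition
with `#O = n' ≥ 1`, `#E = n'' ≥ 1`, let `1 ≤ n1 ≤ n`, `n1' = #(O ∩ [n1])`,
`n1'' = #(E ∩ [n1])`.  Then for every `d ≥ 0`, the number of subsets `S ⊆ {1,…,n}` with
`#(S ∩ O) = n1'`, `#(S ∩ E) = n1''` and `#(S ∩ [n1]) = d` is at most
`(1/d!)·((n1')²/n' + (n1'')²/n'')^d · C(n', n1')·C(n'', n1'')`. -/
theorem mixing_bound_symmetric_groups (n n1 : ℕ) (hn1 : 1 ≤ n1) (hn1n : n1 ≤ n)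
    (O E : Finset (Fin n)) (hdisj : Disjoint O E) (hunion : O ∪ E = Finset.univ)
    (hO : 1 ≤ O.card) (hE : 1 ≤ E.card) (d : ℕ) :
    ((Finset.univ.filter fun S : Finset (Fin n) =>
          (S ∩ O).card = ((Finset.univ.filter fun i : Fin n => (i : ℕ) < n1) ∩ O).card ∧
          (S ∩ E).card = ((Finset.univ.filter fun i : Fin n => (i : ℕ) < n1) ∩ E).card ∧
          (S ∩ (Finset.univ.filter fun i : Fin n => (i : ℕ) < n1)).card = d).card : ℝ)
      ≤ (1 / (Nat.factorial d : ℝ)) *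
          ((((Finset.univ.filter fun i : Fin n => (i : ℕ) < n1) ∩ O).card : ℝ) ^ 2 /
              (O.card : ℝ) +
            (((Finset.univ.filter fun i : Fin n => (i : ℕ) < n1) ∩ E).card : ℝ) ^ 2 /
              (E.card : ℝ)) ^ d *
          (Nat.choose O.card ((Finset.univ.filter fun i : Fin n => (i : ℕ) < n1) ∩ O).card) *
          (Nat.choose E.card ((Finset.univ.filter fun i : Fin n => (i : ℕ) < n1) ∩ E).card) := by
  generalize (Finset.univ.filter fun i : Fin n => (i : ℕ) < n1) = N
  rw [← sum_antidiagonal_pow_div_factorial, Finset.sum_mul, Finset.sum_mul]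
  refine (Nat.cast_le.mpr (card_filter_inter_le_sum_antidiagonal hdisj hunion N _ _ d)).trans ?_
  rw [Nat.cast_sum]
  refine Finset.sum_le_sum fun p _ => ?_
  have h1 := (Nat.cast_le (α := ℝ).mpr (card_filter_card_inter_le
    (Finset.inter_subset_right (s₁ := N) (s₂ := O)) (N ∩ O).card p.1)).trans
    (choose_mul_choose_sub_le hO (Finset.card_le_card Finset.inter_subset_right) p.1)
  have h2 := (Nat.cast_le (α := ℝ).mpr (card_filter_card_inter_le
    (Finset.inter_subset_right (s₁ := N) (s₂ := E)) (N ∩ E).card p.2)).trans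
    (choose_mul_choose_sub_le hE (Finset.card_le_card Finset.inter_subset_right) p.2)
  rw [Nat.cast_mul]
  refine (mul_le_mul h1 h2 (Nat.cast_nonneg _) (by positivity)).trans_eq ?_
  ring
end

section
/- For all integers N ≥ 1 and 0 ≤ h ≤ a ≤ N, the inequality h! · N^h · C(a, h) · C(N − a, a − h) ≤ a^{2h} · C(N, a) holds; equivalently, C(a,h)·C(N−a, a−h)/C(N,a) ≤ (1/h!)·(a²/N)^h as real numbers. -/
theorem Nat.add_mul_choose_le {n k h : ℕ} (hkn : k ≤ n) :
    (n + 1 + h) * n.choose k ≤ (k + 1 + h) * (n + 1).choose (k + 1) := by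
  refine Nat.le_of_mul_le_mul_left ?_ n.succ_pos
  calc (n + 1) * ((n + 1 + h) * n.choose k)
      = (n + 1 + h) * ((n + 1) * n.choose k) := by ring
    _ = (n + 1 + h) * (k + 1) * (n + 1).choose (k + 1) := by
      rw [Nat.add_one_mul_choose_eq]; ring
    _ ≤ (n + 1) * (k + 1 + h) * (n + 1).choose (k + 1) := by
      gcongr ?_ * _
      nlinarith [Nat.mul_le_mul_right h hkn]
    _ = (n + 1) * ((k + 1 + h) * (n + 1).choose (k + 1)) := by ring

theorem Nat.pow_mul_choose_sub_le {N a h : ℕ} (hha : h ≤ a) (haN : a ≤ N) :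
    N ^ h * (N - h).choose (a - h) ≤ a ^ h * N.choose a := by
  induction h with
  | zero => simp
  | succ h ih =>
    have step : N * (N - (h + 1)).choose (a - (h + 1)) ≤ a * (N - h).choose (a - h) := by
      have key := Nat.add_mul_choose_le (n := N - (h + 1)) (k := a - (h + 1)) (h := h) (by omega)
      rwa [show N - (h + 1) + 1 = N - h by omega, show a - (h + 1) + 1 = a - h by omega,
        Nat.sub_add_cancel (by omega : h ≤ N), Nat.sub_add_cancel (by omega : h ≤ a)] at key
    calc N ^ (h + 1) * (N - (h + 1)).choose (a - (h + 1))
        = N ^ h * (N * (N - (h + 1)).choose (a - (h + 1))) := by ring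
      _ ≤ N ^ h * (a * (N - h).choose (a - h)) := by gcongr
      _ = a * (N ^ h * (N - h).choose (a - h)) := by ring
      _ ≤ a * (a ^ h * N.choose a) := Nat.mul_le_mul_left a (ih (by omega))
      _ = a ^ (h + 1) * N.choose a := by ring

/-- **Hypergeometric tail estimate.**  For all integers `N ≥ 1` and `0 ≤ h ≤ a ≤ N`,
`h! · N^h · C(a,h) · C(N-a, a-h) ≤ a^{2h} · C(N,a)`. -/
theorem hypergeometric_tail_estimate (N a h : ℕ) (hN : 1 ≤ N) (hha : h ≤ a) (haN : a ≤ N) :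
    Nat.factorial h * N ^ h * Nat.choose a h * Nat.choose (N - a) (a - h)
      ≤ a ^ (2 * h) * Nat.choose N a := by
  calc Nat.factorial h * N ^ h * Nat.choose a h * Nat.choose (N - a) (a - h)
      = a.descFactorial h * (N ^ h * (N - a).choose (a - h)) := by
        rw [Nat.descFactorial_eq_factorial_mul_choose]; ring
    _ ≤ a ^ h * (N ^ h * (N - h).choose (a - h)) :=
        Nat.mul_le_mul (Nat.descFactorial_le_pow a h)
          (Nat.mul_le_mul_left _ (Nat.choose_le_choose _ (Nat.sub_le_sub_left hha N)))
    _ ≤ a ^ h * (a ^ h * N.choose a) :=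
        Nat.mul_le_mul_left _ (Nat.pow_mul_choose_sub_le hha haN)
    _ = a ^ (2 * h) * N.choose a := by ring
end
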